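/- Let Z : [0,∞) → ℝ be a continuous, increasing function with Z(u) > 0 for u > 0, and suppose there is a constant u₀ ≥ 0 such that the function u ↦ u/Z(u) is non-decreasing for u > u₀. Then for all real u, v ≠ 0 one has |sin(u/v)| ≤ Z(|u| + u₀) / Z(|v| + u₀). -/

import Mathlib

/-- Lemma 2 of the paper: for a continuous, increasing, positive function `Z` on `[0,∞)`
such that `u / Z u` is non-decreasing for `u > u₀`, one has
`|sin (u / v)| ≤ Z (|u| + u₀) / Z (|v| + u₀)` for all `u, v ≠ 0`. -/
theorem sine_quotient_admissible
    (Z : ℝ → ℝ) (u₀ : ℝ)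
    (hZcont : ContinuousOn Z (Set.Ici 0))
    (hZmono : StrictMonoOn Z (Set.Ici 0))
    (hZpos : ∀ u : ℝ, 0 < u → 0 < Z u)
    (hu₀ : 0 ≤ u₀)
    (hratio : ∀ u v : ℝ, u₀ < u → u ≤ v → u / Z u ≤ v / Z v) :
    ∀ u v : ℝ, u ≠ 0 → v ≠ 0 →
      |Real.sin (u / v)| ≤ Z (|u| + u₀) / Z (|v| + u₀) := by
  intro u v hu hv
  have ha : 0 < |u| := abs_pos.mpr hu
  have hb : 0 < |v| := abs_pos.mpr hv
  have hZa : 0 < Z (|u| + u₀) := hZpos _ (by linarith)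
  have hZb : 0 < Z (|v| + u₀) := hZpos _ (by linarith)
  rcases le_total |v| |u| with h | h
  · refine (Real.abs_sin_le_one _).trans ((one_le_div hZb).mpr ?_)
    exact hZmono.monotoneOn (Set.mem_Ici.mpr (by linarith)) (Set.mem_Ici.mpr (by linarith))
      (by linarith)
  · have hr := hratio (|u| + u₀) (|v| + u₀) (by linarith) (by linarith)
    rw [div_le_div_iff₀ hZa hZb] at hr
    calc |Real.sin (u / v)| ≤ |u / v| := Real.abs_sin_le_abs
      _ = |u| / |v| := abs_div u v
      _ ≤ (|u| + u₀) / (|v| + u₀) := by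
        rw [div_le_div_iff₀ hb (by linarith)]
        nlinarith [mul_le_mul_of_nonneg_right h hu₀]
      _ ≤ Z (|u| + u₀) / Z (|v| + u₀) := by
        rw [div_le_div_iff₀ (by linarith) hZb]
        linarith
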